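/- arXiv:1406.1208 — 6 statements merged into one kernel-verified Lean document; each statement's English description precedes it below -/
import Mathlib

section
/- Let A be a unital C*-algebra and let α be a continuous action of the circle group 𝕋 on A. Then α has the continuous Rokhlin property if and only if there exists a norm-continuous path (u_t)_{t∈[1,∞)} of unitaries in A such that α_ζ(u_t) = ζ·u_t for all ζ ∈ 𝕋 and all t ∈ [1,∞), and lim_{t→∞} ‖u_t a − a u_t‖ = 0 for every a ∈ A. -/
open Filter Topology

/-- A continuous action of the circle group `Circle` on a unital C*-algebra `A`:
a family of ⋆-automorphisms, multiplicative in the group variable, and point-norm continuous. -/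
def IsCircleAction {A : Type*} [NormedRing A] [StarRing A] [NormedAlgebra ℂ A]
    (α : Circle → A ≃⋆ₐ[ℂ] A) : Prop :=
  (∀ ζ₁ ζ₂ : Circle, ∀ a : A, α (ζ₁ * ζ₂) a = α ζ₁ (α ζ₂ a)) ∧
    ∀ a : A, Continuous fun ζ : Circle => α ζ a

/-- The continuous Rokhlin property for a circle action on a unital C*-algebra: a norm-continuous
path `(u_t)_{t ∈ [1,∞)}` of unitaries such that `‖α_ζ(u_t) - ζ • u_t‖ → 0` uniformly in `ζ`
and `‖u_t a - a u_t‖ → 0` for every `a`. -/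
def ContinuousRokhlin {A : Type*} [NormedRing A] [StarRing A] [NormedAlgebra ℂ A]
    (α : Circle → A ≃⋆ₐ[ℂ] A) : Prop :=
  ∃ u : ℝ → A,
    ContinuousOn u (Set.Ici (1 : ℝ)) ∧
    (∀ t ∈ Set.Ici (1 : ℝ), u t ∈ unitary A) ∧
    (∀ ε > (0 : ℝ), ∃ T : ℝ, ∀ t ≥ T, ∀ ζ : Circle, ‖α ζ (u t) - (ζ : ℂ) • u t‖ < ε) ∧
    ∀ a : A, Tendsto (fun t : ℝ => ‖u t * a - a * u t‖) atTop (𝓝 0)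

section RokhlinHelpers

open MeasureTheory

theorem rok_average {A : Type*} [CStarAlgebra A]
    (α : Circle → A ≃⋆ₐ[ℂ] A) (hα : IsCircleAction α) :
    ∃ P : A → A, (∀ a b, ‖P a - P b‖ ≤ ‖a - b‖) ∧
      (∀ (ζ : Circle) a, α ζ (P a) = (ζ : ℂ) • P a) ∧
      (∀ a (ε : ℝ), (∀ ζ : Circle, ‖α ζ a - (ζ : ℂ) • a‖ ≤ ε) → ‖P a - a‖ ≤ ε) := by
  let : MeasurableSpace Circle := borel Circle
  have : BorelSpace Circle := ⟨rfl⟩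
  let μ : Measure Circle := Measure.haarMeasure ⊤
  have : IsProbabilityMeasure μ := ⟨by
    have := Measure.haarMeasure_self (K₀ := (⊤ : TopologicalSpace.PositiveCompacts Circle))
    simpa using this⟩
  have : μ.IsMulLeftInvariant := Measure.isMulLeftInvariant_haarMeasure _
  have hcc : Continuous fun ζ : Circle => (ζ : ℂ) := continuous_subtype_val
  have hc : ∀ a : A, Continuous fun ζ : Circle => ((ζ⁻¹ : Circle) : ℂ) • α ζ a := fun a =>
    (hcc.comp (continuous_inv (G := Circle))).smul (hα.2 a)
  have hi : ∀ a : A, Integrable (fun ζ : Circle => ((ζ⁻¹ : Circle) : ℂ) • α ζ a) μ := fun a =>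
    (hc a).integrable_of_hasCompactSupport (HasCompactSupport.of_compactSpace _)
  have hn : ∀ (ζ : Circle) (a : A), ‖(ζ : ℂ) • a‖ = ‖a‖ := fun ζ a => by
    rw [norm_smul, Circle.norm_coe, one_mul]
  have hbound : ∀ (g : Circle → A) (C : ℝ), (∀ ζ, ‖g ζ‖ ≤ C) → ‖∫ ζ, g ζ ∂μ‖ ≤ C := by
    intro g C h
    have := norm_integral_le_of_norm_le_const (μ := μ) (f := g) (C := C) (Eventually.of_forall h)
    simpa using this
  refine ⟨fun a => ∫ ζ, ((ζ⁻¹ : Circle) : ℂ) • α ζ a ∂μ, ?_, ?_, ?_⟩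
  · intro a b
    simp only
    rw [← integral_sub (hi a) (hi b)]
    refine hbound _ _ fun ζ => ?_
    rw [← smul_sub, ← map_sub, hn]
    exact (StarAlgEquiv.norm_map (α ζ) _).le
  · intro ζ a
    simp only
    have hiso : ∀ x, ‖α ζ x‖ = ‖x‖ := fun x =>
      StarAlgEquiv.norm_map (α ζ) x
    let L : A →ₗᵢ[ℂ] A := ⟨((α ζ : A ≃⋆ₐ[ℂ] A).toAlgEquiv.toLinearMap), hiso⟩
    have h1 := L.integral_comp_comm (μ := μ) (fun η : Circle => ((η⁻¹ : Circle) : ℂ) • α η a)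
    have h2 : ∀ x, L x = α ζ x := fun x => rfl
    rw [h2] at h1
    rw [← h1]
    refine Eq.trans (integral_congr_ae (Eventually.of_forall fun η => ?_))
      ((integral_mul_left_eq_self
        (fun η : Circle => (ζ : ℂ) • ((η⁻¹ : Circle) : ℂ) • α η a) ζ).trans (integral_smul _ _))
    simp only [h2]
    rw [map_smul, hα.1, smul_smul]
    congr 1
    rw [← Circle.coe_mul, mul_inv, mul_inv_cancel_left]
  · intro a ε h
    simp only
    have : ∫ _ζ : Circle, a ∂μ = a := by simp
    calc _ = ‖(∫ ζ : Circle, ((ζ⁻¹ : Circle) : ℂ) • α ζ a ∂μ) - ∫ _ζ : Circle, a ∂μ‖ := by rw [this]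
      _ ≤ ε := by
        rw [← integral_sub (hi a) (integrable_const a)]
        refine hbound _ _ fun ζ => ?_
        have e : ((ζ⁻¹ : Circle) : ℂ) • α ζ a - a =
            ((ζ⁻¹ : Circle) : ℂ) • (α ζ a - (ζ : ℂ) • a) := by
          rw [smul_sub, smul_smul, ← Circle.coe_mul, inv_mul_cancel, Circle.coe_one, one_smul]
        rw [e, hn]
        exact h ζ

noncomputable def rokF (r : ℝ) : ℝ := (√r)⁻¹

theorem rokF_cont : ContinuousOn rokF (Set.Icc (1/2) (3/2)) := by
  unfold rokF
  refine ContinuousOn.inv₀ Real.continuous_sqrt.continuousOn fun x hx => ?_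
  have : 0 < x := by linarith [hx.1]
  positivity

theorem rok_spec {A : Type*} [CStarAlgebra A] {b : A} (hb : ‖b - 1‖ ≤ 1/2) :
    spectrum ℝ b ⊆ Set.Icc (1/2) (3/2) := by
  nontriviality A
  intro r hr
  have h1 : r - 1 ∈ spectrum ℝ (b - algebraMap ℝ A 1) := by
    rw [← spectrum.sub_singleton_eq]
    exact ⟨r, hr, 1, rfl, rfl⟩
  have h2 := spectrum.norm_le_norm_of_mem h1
  rw [map_one, Real.norm_eq_abs] at h2
  have := abs_le.1 (h2.trans hb)
  constructor <;> linarith [this.1, this.2]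

noncomputable def rokPol {A : Type*} [CStarAlgebra A] (x : A) : A := x * cfc rokF (star x * x)

theorem rokPol_unitary {A : Type*} [CStarAlgebra A] {x : A} (hx : IsUnit x)
    (hb : ‖star x * x - 1‖ ≤ 1/2) : rokPol x ∈ unitary A := by
  have hs := rok_spec hb
  set b := star x * x with hbdef
  have hsa : IsSelfAdjoint b := .star_mul_self x
  have hc := rokF_cont.mono hs
  have key : cfc rokF b * b * cfc rokF b = 1 := by
    conv_lhs => enter [1, 2]; rw [← cfc_id' ℝ b]
    rw [← cfc_mul rokF (fun r => r) b hc, ← cfc_mul (fun r => rokF r * r) rokF b (hc.mul continuousOn_id) hc]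
    rw [← cfc_one ℝ b]
    refine cfc_congr fun r hr => ?_
    have : 0 < r := by linarith [(hs hr).1]
    have h3 : √r ≠ 0 := by positivity
    simp only [rokF, Pi.one_apply]
    field_simp
    rw [Real.sq_sqrt this.le]
  have hcomm : Commute (cfc rokF b) b := by
    have := cfc_commute_cfc rokF id b
    rwa [cfc_id ℝ b] at this
  have hfsa : star (cfc rokF b) = cfc rokF b := (cfc_predicate (p := IsSelfAdjoint) rokF b).star_eq
  have hst : star (rokPol x) * rokPol x = 1 := by
    rw [rokPol, star_mul, ← hbdef, hfsa, ← key]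
    simp only [hbdef, mul_assoc]
  have hu : IsUnit (cfc rokF b) := by
    refine ⟨⟨cfc rokF b, b * cfc rokF b, by rw [← mul_assoc, key], ?_⟩, rfl⟩
    rw [← hcomm.eq, key]
  have hv : IsUnit (rokPol x) := hx.mul hu
  refine ⟨hst, ?_⟩
  obtain ⟨w, hw⟩ := hv
  rw [← hw] at hst ⊢
  have : star (w : A) = ↑w⁻¹ := (Units.inv_eq_of_mul_eq_one_left hst).symm
  rw [this, Units.mul_inv]

theorem rokPol_equi {A : Type*} [CStarAlgebra A] {x : A} 
    (hb : ‖star x * x - 1‖ ≤ 1/2) (φ : A ≃⋆ₐ[ℂ] A) (ζ : Circle) (h : φ x = (ζ : ℂ) • x) :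
    φ (rokPol x) = (ζ : ℂ) • rokPol x := by
  have hs := rok_spec hb
  have hφb : φ (star x * x) = star x * x := by
    rw [map_mul, map_star, h, star_smul, smul_mul_smul_comm]
    have : star (ζ : ℂ) * ζ = 1 := by
      rw [Complex.star_def, mul_comm, Complex.mul_conj]; simp
    rw [this, one_smul]
  have hφc : Continuous φ := (StarAlgEquiv.isometry φ).continuous
  have := StarAlgHomClass.map_cfc (R := ℝ) (S := ℂ) φ rokF (star x * x) (rokF_cont.mono hs) hφc
    (.star_mul_self x) (by rw [hφb]; exact .star_mul_self x)
  rw [rokPol, map_mul, this, hφb, h, smul_mul_assoc]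

theorem rok_close {A : Type*} [CStarAlgebra A] {x u : A} (hu : u ∈ unitary A) :
    ‖star x * x - 1‖ ≤ ‖x - u‖ * (‖x - u‖ + 2) := by
  nontriviality A
  have h1 : star x * x - 1 = star x * (x - u) + star (x - u) * u := by
    rw [← hu.1, star_sub]; noncomm_ring
  have hun : ‖u‖ = 1 := CStarRing.norm_of_mem_unitary hu
  have hx : ‖x‖ ≤ ‖x - u‖ + 1 := by
    have := norm_add_le (x - u) u
    rw [sub_add_cancel, hun] at this; exact this
  have h2 := norm_add_le (star x * (x - u)) (star (x - u) * u)
  have h3 := norm_mul_le (star x) (x - u)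
  have h4 := norm_mul_le (star (x - u)) u
  rw [norm_star] at h3 h4
  rw [h1]
  rw [hun] at h4
  nlinarith [norm_nonneg (x - u)]

theorem rok_unit {A : Type*} [CStarAlgebra A] {x u : A} (hu : u ∈ unitary A)
    (h : ‖x - u‖ < 1) : IsUnit x := by
  nontriviality A
  let U : Aˣ := Unitary.toUnits ⟨u, hu⟩
  have hU : (U : A) = u := rfl
  have hUi : ‖(↑U⁻¹ : A)‖ = 1 := CStarRing.norm_of_mem_unitary (Unitary.star_mem hu)
  refine ⟨U.ofNearby x ?_, rfl⟩
  rw [hUi, hU]; simpa using h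

theorem rok_main {A : Type*} [CStarAlgebra A] [Nontrivial A]
    (α : Circle → A ≃⋆ₐ[ℂ] A) (hα : IsCircleAction α) (hR : ContinuousRokhlin α) :
      ∃ u : ℝ → A,
        ContinuousOn u (Set.Ici (1 : ℝ)) ∧
        (∀ t ∈ Set.Ici (1 : ℝ), u t ∈ unitary A) ∧
        (∀ t ∈ Set.Ici (1 : ℝ), ∀ ζ : Circle, α ζ (u t) = (ζ : ℂ) • u t) ∧
        ∀ a : A, Tendsto (fun t : ℝ => ‖u t * a - a * u t‖) atTop (𝓝 0) := by
  obtain ⟨u, huc, huu, hue, hua⟩ := hR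
  obtain ⟨P, hP1, hP2, hP3⟩ := rok_average α hα
  obtain ⟨T, hT⟩ := hue (1/8) (by norm_num)
  let τ : ℝ → ℝ := fun t => max t (max T 1)
  have hτ1 : ∀ t, 1 ≤ τ t := fun t => le_max_of_le_right (le_max_right _ _)
  have hτT : ∀ t, T ≤ τ t := fun t => le_max_of_le_right (le_max_left _ _)
  have hτc : Continuous τ := continuous_id.max continuous_const
  have hwc : Continuous fun t => u (τ t) := huc.comp_continuous hτc hτ1
  let x : ℝ → A := fun t => P (u (τ t))
  have hPc : Continuous P := (LipschitzWith.of_dist_le_mul (K := 1) fun a b => by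
    rw [dist_eq_norm, dist_eq_norm, NNReal.coe_one, one_mul]; exact hP1 a b).continuous
  have hxc : Continuous x := hPc.comp hwc
  have hxu : ∀ t, ‖x t - u (τ t)‖ ≤ 1/8 := fun t => hP3 _ _ fun ζ => (hT _ (hτT t) ζ).le
  have hxb : ∀ t, ‖star (x t) * x t - 1‖ ≤ 1/2 := fun t => by
    have := rok_close (x := x t) (huu _ (hτ1 t))
    nlinarith [hxu t, norm_nonneg (x t - u (τ t))]
  have hxlim : Tendsto (fun t => x t - u (τ t)) atTop (𝓝 0) := by
    rw [Metric.tendsto_atTop]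
    intro ε hε
    obtain ⟨S, hS⟩ := hue (ε/2) (by linarith)
    refine ⟨S, fun t ht => ?_⟩
    rw [dist_zero_right]
    have := hP3 (u (τ t)) (ε/2) fun ζ => (hS _ (ht.trans (le_max_left _ _)) ζ).le
    have h' : ‖x t - u (τ t)‖ ≤ ε/2 := this
    linarith
  have hblim : Tendsto (fun t => star (x t) * x t) atTop (𝓝 1) := by
    rw [tendsto_iff_norm_sub_tendsto_zero]
    have h0 : Tendsto (fun t => ‖x t - u (τ t)‖ * (‖x t - u (τ t)‖ + 2)) atTop (𝓝 0) := by
      have := hxlim.norm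
      rw [norm_zero] at this
      simpa using this.mul (this.add_const 2)
    exact squeeze_zero (fun _ => norm_nonneg _) (fun t => rok_close (huu _ (hτ1 t))) h0
  have hflim : Tendsto (fun t => cfc rokF (star (x t) * x t)) atTop (𝓝 1) := by
    have h1 : cfc rokF (1 : A) = 1 := by
      rw [cfc_apply_one]; simp [rokF]
    have := Filter.Tendsto.cfc (p := IsSelfAdjoint) (isCompact_Icc) rokF hblim
      (Eventually.of_forall fun t => rok_spec (hxb t))
      (Eventually.of_forall fun t => .star_mul_self (x t))
      (rok_spec (by simp)) (IsSelfAdjoint.one A) rokF_cont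
    rwa [h1] at this
  have hvlim : Tendsto (fun t => rokPol (x t) - u (τ t)) atTop (𝓝 0) := by
    have h1 : ∀ t, rokPol (x t) - u (τ t) =
        x t * (cfc rokF (star (x t) * x t) - 1) + (x t - u (τ t)) := fun t => by
      rw [rokPol]; noncomm_ring
    have h2 : Tendsto (fun t => x t * (cfc rokF (star (x t) * x t) - 1)) atTop (𝓝 0) := by
      refine squeeze_zero_norm (a := fun t => 2 * ‖cfc rokF (star (x t) * x t) - 1‖) (fun t => ?_) ?_
      · refine (norm_mul_le _ _).trans ?_
        gcongr
        have := norm_add_le (x t - u (τ t)) (u (τ t))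
        rw [sub_add_cancel, CStarRing.norm_of_mem_unitary (huu _ (hτ1 t))] at this
        linarith [hxu t]
      · have := (hflim.sub_const 1).norm.const_mul 2
        simpa using this
    simpa [h1] using h2.add hxlim
  refine ⟨fun t => rokPol (x t), ?_, ?_, ?_, ?_⟩
  · refine Continuous.continuousOn (hxc.mul ?_)
    rw [continuous_iff_continuousAt]
    intro t
    exact ContinuousAt.cfc (p := IsSelfAdjoint) isCompact_Icc rokF (hxc.star.mul hxc).continuousAt
      (Eventually.of_forall fun t => rok_spec (hxb t))
      (Eventually.of_forall fun t => .star_mul_self (x t)) rokF_cont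
  · intro t _
    exact rokPol_unitary (rok_unit (huu _ (hτ1 t)) ((hxu t).trans_lt (by norm_num))) (hxb t)
  · intro t _ ζ
    exact rokPol_equi (hxb t) (α ζ) ζ (hP2 ζ _)
  · intro a
    have hτ : Tendsto τ atTop atTop := tendsto_atTop_mono (fun t => le_max_left _ _) tendsto_id
    have h1 := tendsto_zero_iff_norm_tendsto_zero.2 ((hua a).comp hτ)
    have h2 := (hvlim.mul_const a).sub (hvlim.const_mul a)
    have h3 := (h1.add h2).norm
    simp only [zero_mul, mul_zero, sub_zero, add_zero, norm_zero] at h3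
    refine h3.congr fun t => ?_
    congr 1
    simp only [Function.comp]
    noncomm_ring

end RokhlinHelpers

theorem continuousRokhlin_iff_exact_path {A : Type*} [NormedRing A] [StarRing A] [CStarRing A]
    [NormedAlgebra ℂ A] [StarModule ℂ A] [CompleteSpace A] [Nontrivial A]
    (α : Circle → A ≃⋆ₐ[ℂ] A) (hα : IsCircleAction α) :
    ContinuousRokhlin α ↔
      ∃ u : ℝ → A,
        ContinuousOn u (Set.Ici (1 : ℝ)) ∧
        (∀ t ∈ Set.Ici (1 : ℝ), u t ∈ unitary A) ∧
        (∀ t ∈ Set.Ici (1 : ℝ), ∀ ζ : Circle, α ζ (u t) = (ζ : ℂ) • u t) ∧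
        ∀ a : A, Tendsto (fun t : ℝ => ‖u t * a - a * u t‖) atTop (𝓝 0) := by
  constructor
  · intro h
    let : CStarAlgebra A := {}
    exact rok_main α hα h
  · rintro ⟨u, h1, h2, h3, h4⟩
    refine ⟨u, h1, h2, fun ε hε => ⟨1, fun t ht ζ => ?_⟩, h4⟩
    rw [h3 t ht ζ, sub_self, norm_zero]
    exact hε
end

section
/- Let G be a finite group, let A be a unital C*-algebra over ℂ, and let α : G → Aut(A) be an action of G by ⋆-automorphisms. Suppose that for each g ∈ G there is a norm-continuous path (e_g^{(t)})_{t∈[0,∞)} of projections (self-adjoint idempotents) in A such that for all t ∈ [0,∞): α_g(e_h^{(t)}) = e_{gh}^{(t)} for all g, h ∈ G; Σ_{g∈G} e_g^{(t)} = 1; and lim_{t→∞} ‖e_g^{(t)} a − a e_g^{(t)}‖ = 0 for all a ∈ A and all g ∈ G. For t ∈ [0,∞) define ψ_t : A → A by ψ_t(a) = Σ_{g∈G} e_g^{(t)} · α_g(a) · e_g^{(t)}. Then: (i) each ψ_t is ℂ-linear, unital, takes values in the fixed point algebra A^α = {a ∈ A : α_g(a) = a for all g ∈ G}, and is completely positive,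 i.e. for every n ∈ ℕ and all a_1,…,a_n, b_1,…,b_n ∈ A one has 0 ≤ Σ_{i,j=1}^{n} b_i⋆ · ψ_t(a_i⋆ a_j) · b_j in the canonical partial order of A; (ii) for every a ∈ A the map t ↦ ψ_t(a) is norm-continuous; (iii) lim_{t→∞} ‖ψ_t(ab) − ψ_t(a)ψ_t(b)‖ = 0 for all a, b ∈ A; (iv) lim_{t→∞} ‖ψ_t(a) − a‖ = 0 for every a ∈ A^α. -/
open Filter Topology

/-- An action of a group `G` on a unital C*-algebra `A` by ⋆-automorphisms:
a family of ⋆-automorphisms, multiplicative in the group variable. -/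
def IsGroupAction {G : Type*} [Group G] {A : Type*} [CStarAlgebra A]
    (α : G → A ≃⋆ₐ[ℂ] A) : Prop :=
  ∀ g h : G, ∀ a : A, α (g * h) a = α g (α h a)

theorem proj_norm_le_one_aux {A : Type*} [CStarAlgebra A] (p : A)
    (h1 : star p = p) (h2 : p * p = p) : ‖p‖ ≤ 1 := by
  have h : ‖p‖ = ‖p‖ * ‖p‖ := by
    have := CStarRing.norm_star_mul_self (x := p)
    rwa [h1, h2] at this
  by_contra hc
  push Not at hc
  nlinarith

theorem proj_orth_aux {G : Type*} [Fintype G] {A : Type*} [CStarAlgebra A]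
    [PartialOrder A] [StarOrderedRing A] (p : G → A)
    (h1 : ∀ g, star (p g) = p g) (h2 : ∀ g, p g * p g = p g)
    (hs : ∑ g, p g = 1) (g h : G) (hgh : g ≠ h) : p g * p h = 0 := by
  classical
  have key : ∀ k, p h * p k * p h = star (p k * p h) * (p k * p h) := by
    intro k
    rw [star_mul, h1, h1, mul_assoc (p h) (p k) (p k * p h), ← mul_assoc (p k) (p k), h2, mul_assoc]
  have hsum : ∑ k, p h * p k * p h = p h := by
    rw [← Finset.sum_mul, ← Finset.mul_sum, hs, mul_one, h2]
  rw [← Finset.add_sum_erase _ _ (Finset.mem_univ h), h2, h2] at hsum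
  have h0 : ∑ k ∈ Finset.univ.erase h, p h * p k * p h = 0 := by simpa using hsum
  rw [Finset.sum_eq_zero_iff_of_nonneg] at h0
  · have := h0 g (Finset.mem_erase.2 ⟨hgh, Finset.mem_univ _⟩)
    rw [key] at this
    exact (CStarRing.star_mul_self_eq_zero_iff _).1 this
  · intro k _
    rw [key]
    exact star_mul_self_nonneg _

theorem finite_group_continuous_rokhlin_asymptotic_morphism
    {G : Type*} [Group G] [Fintype G] {A : Type*} [CStarAlgebra A] [Nontrivial A]
    [PartialOrder A] [StarOrderedRing A]
    (α : G → A ≃⋆ₐ[ℂ] A) (hα : IsGroupAction α)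
    (e : G → ℝ → A)
    (he_cont : ∀ g : G, ContinuousOn (e g) (Set.Ici (0 : ℝ)))
    (he_proj : ∀ g : G, ∀ t ∈ Set.Ici (0 : ℝ),
      star (e g t) = e g t ∧ e g t * e g t = e g t)
    (he_equiv : ∀ g h : G, ∀ t ∈ Set.Ici (0 : ℝ), α g (e h t) = e (g * h) t)
    (he_sum : ∀ t ∈ Set.Ici (0 : ℝ), ∑ g : G, e g t = 1)
    (he_comm : ∀ g : G, ∀ a : A,
      Tendsto (fun t : ℝ => ‖e g t * a - a * e g t‖) atTop (𝓝 0))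
    (ψ : ℝ → A → A)
    (hψ : ∀ t : ℝ, ∀ a : A, ψ t a = ∑ g : G, e g t * α g a * e g t) :
    (∀ t ∈ Set.Ici (0 : ℝ),
      IsLinearMap ℂ (ψ t) ∧
      ψ t 1 = 1 ∧
      (∀ a : A, ∀ g : G, α g (ψ t a) = ψ t a) ∧
      (∀ n : ℕ, ∀ a b : Fin n → A,
        0 ≤ ∑ i : Fin n, ∑ j : Fin n, star (b i) * ψ t (star (a i) * a j) * b j)) ∧
    (∀ a : A, ContinuousOn (fun t : ℝ => ψ t a) (Set.Ici (0 : ℝ))) ∧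
    (∀ a b : A, Tendsto (fun t : ℝ => ‖ψ t (a * b) - ψ t a * ψ t b‖) atTop (𝓝 0)) ∧
    (∀ a : A, (∀ g : G, α g a = a) →
      Tendsto (fun t : ℝ => ‖ψ t a - a‖) atTop (𝓝 0)) := by
  have hpt : ∀ t ∈ Set.Ici (0 : ℝ), ∀ g a b,
      e g t * (α g a * (α g b * e g t - e g t * α g b) * e g t) =
      e g t * α g (a * b) * e g t - e g t * α g a * e g t * α g b * e g t := by
    intro t ht g a b
    have h2 := (he_proj g t ht).2
    rw [map_mul]
    simp only [mul_sub, sub_mul, mul_assoc, h2]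
  refine ⟨fun t ht => ⟨⟨?_, ?_⟩, ?_, ?_, ?_⟩, ?_, ?_, ?_⟩
  · intro a b
    simp only [hψ, map_add, mul_add, add_mul, Finset.sum_add_distrib]
  · intro c a
    simp only [hψ, map_smul, mul_smul_comm, smul_mul_assoc, Finset.smul_sum]
  · rw [hψ, ← he_sum t ht]
    refine Finset.sum_congr rfl fun g _ => ?_
    rw [he_sum t ht, map_one, mul_one, (he_proj g t ht).2]
  · intro a g
    rw [hψ, map_sum]
    refine Fintype.sum_equiv (Equiv.mulLeft g) _ _ fun h => ?_
    rw [map_mul, map_mul, he_equiv g h t ht, ← hα]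
    rfl
  · intro n a b
    have : ∑ i : Fin n, ∑ j : Fin n, star (b i) * ψ t (star (a i) * a j) * b j =
        ∑ g : G, star (∑ j, α g (a j) * e g t * b j) * (∑ j, α g (a j) * e g t * b j) := by
      simp only [hψ, star_sum, Finset.mul_sum, Finset.sum_mul]
      rw [Finset.sum_congr rfl fun i _ => Finset.sum_comm]
      rw [Finset.sum_comm]
      refine Finset.sum_congr rfl fun g _ => ?_
      rw [Finset.sum_comm]
      refine Finset.sum_congr rfl fun i _ => ?_
      refine Finset.sum_congr rfl fun j _ => ?_
      rw [star_mul, star_mul, (he_proj g t ht).1, map_mul, map_star]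
      simp only [mul_assoc]
    rw [this]
    exact Finset.sum_nonneg fun g _ => star_mul_self_nonneg _
  · intro a
    simp only [hψ]
    exact continuousOn_finsetSum _ fun g _ =>
      ((he_cont g).mul continuousOn_const).mul (he_cont g)
  · intro a b
    have hlim : Tendsto (fun t : ℝ => ∑ g : G, ‖α g a‖ * ‖e g t * α g b - α g b * e g t‖)
        atTop (𝓝 0) := by
      have := tendsto_finsetSum (Finset.univ : Finset G) fun g _ =>
        (he_comm g (α g b)).const_mul ‖α g a‖
      simpa using this
    refine squeeze_zero' (Eventually.of_forall fun t => norm_nonneg _) ?_ hlim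
    filter_upwards [eventually_ge_atTop (0 : ℝ)] with t ht
    have hprod : ψ t a * ψ t b = ∑ g : G, e g t * α g a * e g t * α g b * e g t := by
      rw [hψ, hψ, Finset.sum_mul_sum]
      refine Finset.sum_congr rfl fun g _ => ?_
      rw [Finset.sum_eq_single g]
      · have h2 := (he_proj g t ht).2
        calc _ = e g t * α g a * (e g t * e g t) * α g b * e g t := by simp only [mul_assoc]
          _ = _ := by rw [h2]
      · intro h _ hh
        have h0 := proj_orth_aux (fun g => e g t) (fun g => (he_proj g t ht).1)
          (fun g => (he_proj g t ht).2) (he_sum t ht) g h hh.symm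
        calc _ = e g t * α g a * (e g t * e h t) * α h b * e h t := by simp only [mul_assoc]
          _ = _ := by rw [h0]; simp
      · simp
    rw [hprod, hψ, ← Finset.sum_sub_distrib]
    refine norm_sum_le_of_le _ fun g _ => ?_
    rw [← hpt t ht]
    have hn := proj_norm_le_one_aux _ (he_proj g t ht).1 (he_proj g t ht).2
    calc _ ≤ ‖e g t‖ * (‖α g a‖ * ‖α g b * e g t - e g t * α g b‖ * ‖e g t‖) := by
          refine (norm_mul_le _ _).trans ?_
          gcongr
          refine (norm_mul_le _ _).trans ?_
          gcongr
          exact norm_mul_le _ _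
      _ ≤ 1 * (‖α g a‖ * ‖α g b * e g t - e g t * α g b‖ * 1) := by gcongr
      _ = _ := by rw [one_mul, mul_one, norm_sub_rev]
  · intro a ha
    have hlim : Tendsto (fun t : ℝ => ∑ g : G, ‖e g t * a - a * e g t‖) atTop (𝓝 0) := by
      have := tendsto_finsetSum (Finset.univ : Finset G) fun g _ => he_comm g a
      simpa using this
    refine squeeze_zero' (Eventually.of_forall fun t => norm_nonneg _) ?_ hlim
    filter_upwards [eventually_ge_atTop (0 : ℝ)] with t ht
    have h1 : ψ t a - a = ∑ g : G, e g t * (a * e g t - e g t * a) := by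
      have : a = ∑ g : G, e g t * a := by rw [← Finset.sum_mul, he_sum t ht, one_mul]
      conv_lhs => rw [hψ]; arg 2; rw [this]
      rw [← Finset.sum_sub_distrib]
      refine Finset.sum_congr rfl fun g _ => ?_
      rw [ha, mul_sub, ← mul_assoc, ← mul_assoc, (he_proj g t ht).2]
    rw [h1]
    refine norm_sum_le_of_le _ fun g _ => ?_
    have hn := proj_norm_le_one_aux _ (he_proj g t ht).1 (he_proj g t ht).2
    calc _ ≤ ‖e g t‖ * ‖a * e g t - e g t * a‖ := norm_mul_le _ _
      _ ≤ 1 * ‖a * e g t - e g t * a‖ := by gcongr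
      _ = _ := by rw [one_mul, norm_sub_rev]
end

section
/- Let X be a compact Hausdorff space equipped with a continuous action of the circle group 𝕋. Then the induced action α of 𝕋 on C(X) has the Rokhlin property if and only if there exists an equivariant homeomorphism from X onto 𝕋 × (X/𝕋), where 𝕋 acts on 𝕋 × (X/𝕋) by translation on the first factor and trivially on the second, i.e. ζ·(w, y) = (ζw, y). -/
/-- The induced action of `ζ ∈ 𝕋` on `C(X, ℂ)`: `(α_ζ f)(x) = f(ζ⁻¹ • x)`. -/
noncomputable def inducedAct {X : Type*} [TopologicalSpace X] [MulAction Circle X]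
    [ContinuousSMul Circle X] (ζ : Circle) (f : C(X, ℂ)) : C(X, ℂ) :=
  f.comp ⟨fun x => ζ⁻¹ • x, continuous_const_smul _⟩

/-- The Rokhlin property for the induced circle action on `C(X, ℂ)`. -/
def RokhlinC (X : Type*) [TopologicalSpace X] [CompactSpace X] [T2Space X]
    [MulAction Circle X] [ContinuousSMul Circle X] : Prop :=
  ∀ ε > (0 : ℝ), ∀ F : Finset C(X, ℂ), ∃ u ∈ unitary C(X, ℂ),
    (∀ ζ : Circle, ‖inducedAct ζ u - (ζ : ℂ) • u‖ < ε) ∧ ∀ a ∈ F, ‖u * a - a * u‖ < ε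

/-- Averaging an approximately equivariant unitary. -/
theorem exists_equivariant_fun (X : Type*) [TopologicalSpace X]
    [CompactSpace X] [T2Space X] [MulAction Circle X] [ContinuousSMul Circle X] (h : RokhlinC X) :
    ∃ v : C(X, ℂ), (∀ x, v x ≠ 0) ∧
      ∀ (ζ : Circle) (x : X), v (ζ • x) = ((ζ⁻¹ : Circle) : ℂ) * v x := by
  obtain ⟨u, hu, hρ, -⟩ := h (1/2) (by norm_num) ∅
  have hnorm : ∀ x, ‖u x‖ = 1 := by
    intro x
    have h1 := congrArg (fun f : C(X, ℂ) => f x) (Unitary.star_mul_self_of_mem hu)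
    simp only [ContinuousMap.mul_apply, ContinuousMap.star_apply, ContinuousMap.one_apply] at h1
    have h2 := congrArg norm h1
    rw [norm_mul, norm_star, norm_one] at h2
    nlinarith [norm_nonneg (u x)]
  have hclose : ∀ (ζ : Circle) (x : X), ‖(ζ : ℂ) * u (ζ • x) - u x‖ ≤ 1/2 := by
    intro ζ x
    have h1 := (ContinuousMap.norm_coe_le_norm _ x).trans (hρ ζ⁻¹).le
    have h2 : ‖u (ζ • x) - ((ζ⁻¹ : Circle) : ℂ) * u x‖ ≤ 1/2 := by
      simpa [inducedAct] using h1
    have h3 : (ζ : ℂ) * u (ζ • x) - u x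
        = (ζ : ℂ) * (u (ζ • x) - ((ζ⁻¹ : Circle) : ℂ) * u x) := by
      rw [Circle.coe_inv]
      field_simp [Circle.coe_ne_zero ζ]
    rw [h3, norm_mul, Circle.norm_coe, one_mul]
    exact h2
  let G : C(ℝ × X, ℂ) :=
    ⟨fun p => (Circle.exp p.1 : ℂ) * u (Circle.exp p.1 • p.2), by fun_prop⟩
  have hGi : IntervalIntegrable (fun θ => G.curry θ) MeasureTheory.volume 0 (2 * Real.pi) :=
    G.curry.continuous.intervalIntegrable _ _
  let V : C(X, ℂ) := ∫ θ in (0:ℝ)..(2 * Real.pi), G.curry θ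
  have hV : ∀ x, V x = ∫ θ in (0:ℝ)..(2 * Real.pi),
      (Circle.exp θ : ℂ) * u (Circle.exp θ • x) := by
    intro x
    exact ((ContinuousMap.evalCLM ℂ x).intervalIntegral_comp_comm hGi).symm
  have hci : ∀ x : X, Continuous fun θ : ℝ => (Circle.exp θ : ℂ) * u (Circle.exp θ • x) := by
    intro x; fun_prop
  refine ⟨V, ?_, ?_⟩
  · intro x hx
    have h1 : ‖∫ θ in (0:ℝ)..(2 * Real.pi),
        ((Circle.exp θ : ℂ) * u (Circle.exp θ • x) - u x)‖ ≤ 1/2 * |2 * Real.pi - 0| :=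
      intervalIntegral.norm_integral_le_of_norm_le_const fun θ _ => hclose _ x
    rw [intervalIntegral.integral_sub ((hci x).intervalIntegrable _ _) (by simp), ← hV, hx,
      intervalIntegral.integral_const, zero_sub, norm_neg, norm_smul, hnorm, sub_zero,
      Real.norm_eq_abs] at h1
    have := Real.pi_pos
    have h2 : 0 < |2 * Real.pi| := by positivity
    linarith
  · intro ζ x
    obtain ⟨t, rfl⟩ : ∃ t, Circle.exp t = ζ := ⟨_, Circle.exp_arg ζ⟩
    have hp : Function.Periodic
        (fun θ : ℝ => (Circle.exp θ : ℂ) * u (Circle.exp θ • x)) (2 * Real.pi) := by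
      intro θ
      simp only [Circle.periodic_exp θ]
    have h1 := hp.intervalIntegral_add_eq t 0
    have h2 := intervalIntegral.integral_comp_add_right (a := 0) (b := 2 * Real.pi)
      (fun θ : ℝ => (Circle.exp θ : ℂ) * u (Circle.exp θ • x)) t
    rw [hV, hV, ← intervalIntegral.integral_const_mul]
    rw [zero_add, add_comm (2 * Real.pi) t, h1, zero_add] at h2
    rw [intervalIntegral.integral_const_mul, ← h2, ← intervalIntegral.integral_const_mul]
    congr 1
    ext θ
    rw [Circle.exp_add, mul_smul, Circle.coe_mul, Circle.coe_inv]
    field_simp [Circle.coe_ne_zero]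

/-- A circle action on a compact Hausdorff space `X` induces an action on `C(X)` with the
Rokhlin property if and only if `X` is equivariantly homeomorphic to `𝕋 × (X/𝕋)`, with the
translation action on the first factor and the trivial action on the second. -/
theorem rokhlinC_iff_equivariant_trivialization (X : Type*) [TopologicalSpace X]
    [CompactSpace X] [T2Space X] [MulAction Circle X] [ContinuousSMul Circle X] :
    RokhlinC X ↔
      ∃ φ : X ≃ₜ Circle × Quotient (MulAction.orbitRel Circle X),
        ∀ (ζ : Circle) (x : X), φ (ζ • x) = (ζ * (φ x).1, (φ x).2) := by
  constructor
  · intro h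
    obtain ⟨v, hv0, hv⟩ := exists_equivariant_fun X h
    let k : X → Circle := fun x => ⟨v x / (‖v x‖ : ℂ), by
      change v x / (‖v x‖ : ℂ) ∈ Metric.sphere (0:ℂ) 1
      rw [mem_sphere_zero_iff_norm, norm_div, Complex.norm_real, norm_norm,
        div_self (norm_ne_zero_iff.2 (hv0 x))]⟩
    let g : X → Circle := fun x => (k x)⁻¹
    have hgc : Continuous g := by
      refine Continuous.inv (Continuous.subtype_mk ?_ _)
      refine v.continuous.div (by fun_prop) ?_
      intro x
      exact_mod_cast norm_ne_zero_iff.2 (hv0 x)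
    have hg : ∀ (ζ : Circle) x, g (ζ • x) = ζ * g x := by
      intro ζ x
      rw [← inv_inj, mul_inv]
      change (k (ζ • x))⁻¹⁻¹ = ζ⁻¹ * (k x)⁻¹⁻¹
      rw [inv_inv, inv_inv]
      ext
      simp only [Circle.coe_mul]
      change v (ζ • x) / (‖v (ζ • x)‖ : ℂ) = ((ζ⁻¹ : Circle) : ℂ) * (v x / (‖v x‖ : ℂ))
      rw [hv, norm_mul, Circle.norm_coe, one_mul, mul_div_assoc]
    let s : Quotient (MulAction.orbitRel Circle X) → X :=
      Quotient.lift (fun x => (g x)⁻¹ • x) (by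
        rintro a b ⟨ζ, rfl⟩
        simp only [hg, mul_inv, smul_smul]
        congr 1
        rw [mul_right_comm, inv_mul_cancel, one_mul])
    have hs : Continuous s := Continuous.quotient_lift (by fun_prop) _
    refine ⟨{ toFun := fun x => (g x, Quotient.mk _ x)
              invFun := fun p => p.1 • s p.2
              left_inv := ?_
              right_inv := ?_
              continuous_toFun := hgc.prodMk continuous_quotient_mk'
              continuous_invFun := by fun_prop }, ?_⟩
    · intro x
      simp [s]
    · rintro ⟨z, q⟩
      induction q using Quotient.inductionOn with
      | h x =>
        refine Prod.ext ?_ ?_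
        · simp [s, hg]
        · refine Quotient.sound ⟨z * (g x)⁻¹, ?_⟩
          simp [s, smul_smul]
    · intro ζ x
      refine Prod.ext (hg ζ x) ?_
      exact Quotient.sound ⟨ζ, rfl⟩
  · rintro ⟨φ, hφ⟩ ε hε F
    let u : C(X, ℂ) := ⟨fun x => (((φ x).1⁻¹ : Circle) : ℂ), by fun_prop⟩
    refine ⟨u, ?_, ?_, ?_⟩
    · rw [Unitary.mem_iff]
      constructor <;> ext x <;>
      simp [u, ← Circle.coe_inv_eq_conj]
    · intro ζ
      have : inducedAct ζ u - (ζ : ℂ) • u = 0 := by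
        ext x
        simp [u, inducedAct, hφ, mul_comm]
      rw [this, norm_zero]
      exact hε
    · intro a _
      rw [mul_comm, sub_self, norm_zero]
      exact hε
end

section
/- Let X be a compact Hausdorff space equipped with a continuous action of the circle group 𝕋. If the induced action α of 𝕋 on C(X) has the Rokhlin property, then the action of 𝕋 on X is free, i.e. for every ζ ∈ 𝕋 and x ∈ X, ζ·x = x implies ζ = 1. -/
/-- If the induced circle action on `C(X)` has the Rokhlin property, then the circle action
on `X` is free. -/
theorem free_of_rokhlinC (X : Type*) [TopologicalSpace X] [CompactSpace X] [T2Space X]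
    [MulAction Circle X] [ContinuousSMul Circle X] (h : RokhlinC X) :
    ∀ (ζ : Circle) (x : X), ζ • x = x → ζ = 1 := by
  intro ζ x hx
  by_contra hne
  have hpos : 0 < ‖(1 : ℂ) - (ζ : ℂ)‖ := by
    rw [norm_pos_iff, sub_ne_zero]
    intro h1
    exact hne (Circle.ext (by simpa using h1.symm))
  obtain ⟨u, hu, h1, -⟩ := h _ hpos ∅
  have hux : star (u x) * u x = 1 := by
    have := congrArg (fun f : C(X, ℂ) => f x) (Unitary.star_mul_self_of_mem hu)
    simpa using this
  have hn : ‖u x‖ = 1 := by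
    have h2 := congrArg norm hux
    rw [norm_mul, norm_star, norm_one] at h2
    nlinarith [norm_nonneg (u x)]
  have hinv : ζ⁻¹ • x = x := by
    rw [inv_smul_eq_iff, hx]
  have h3 := lt_of_le_of_lt
    (ContinuousMap.norm_coe_le_norm (inducedAct ζ u - (ζ : ℂ) • u) x) (h1 ζ)
  have h4 : (inducedAct ζ u - (ζ : ℂ) • u) x = (1 - (ζ : ℂ)) * u x := by
    have h5 : inducedAct ζ u x = u x := by
      change u (ζ⁻¹ • x) = u x
      rw [hinv]
    rw [ContinuousMap.sub_apply, h5, ContinuousMap.smul_apply, smul_eq_mul]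
    ring
  rw [h4, norm_mul, hn, mul_one] at h3
  exact lt_irrefl _ h3
end

section
/- Let X be a compact Hausdorff space equipped with a free continuous action of the circle group 𝕋, and suppose j : X/𝕋 → X is a continuous map with π(j(y)) = y for all y ∈ X/𝕋. Then there is a unique function u : X → 𝕋 such that u(x)·j(π(x)) = x for all x ∈ X; moreover this u is continuous and satisfies u(ζ·x) = ζ·u(x) for all ζ ∈ 𝕋 and x ∈ X. -/
/-- Given a free continuous circle action on a compact Hausdorff space `X` and a continuous
section `j` of the quotient map `π : X → X/𝕋`, there is a unique `u : X → 𝕋` with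
`u(x) • j(π(x)) = x` for all `x`; moreover this `u` is continuous and satisfies
`u(ζ • x) = ζ * u(x)`. -/
theorem exists_unique_cocycle_of_section (X : Type*) [TopologicalSpace X] [CompactSpace X]
    [T2Space X] [MulAction Circle X] [ContinuousSMul Circle X]
    (hfree : ∀ (ζ : Circle) (x : X), ζ • x = x → ζ = 1)
    (j : Quotient (MulAction.orbitRel Circle X) → X) (hj_cont : Continuous j)
    (hj : ∀ y : Quotient (MulAction.orbitRel Circle X),
      Quotient.mk (MulAction.orbitRel Circle X) (j y) = y) :
    (∃! u : X → Circle,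
      ∀ x : X, u x • j (Quotient.mk (MulAction.orbitRel Circle X) x) = x) ∧
    ∀ u : X → Circle,
      (∀ x : X, u x • j (Quotient.mk (MulAction.orbitRel Circle X) x) = x) →
        Continuous u ∧ ∀ (ζ : Circle) (x : X), u (ζ • x) = ζ * u x := by
  have hcancel : ∀ (a b : Circle) (x : X), a • x = b • x → a = b := by
    intro a b x h
    have h1 : (b⁻¹ * a) • x = x := by rw [mul_smul, h, inv_smul_smul]
    exact (inv_mul_eq_one.mp (hfree _ _ h1)).symm
  have hex : ∀ x : X, ∃ z : Circle,
      z • j (Quotient.mk (MulAction.orbitRel Circle X) x) = x := by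
    intro x
    have h := Quotient.exact (hj (Quotient.mk (MulAction.orbitRel Circle X) x))
    have h2 := MulAction.orbitRel_apply.mp ((MulAction.orbitRel Circle X).symm h)
    exact h2
  choose v hv using hex
  refine ⟨⟨v, hv, ?_⟩, ?_⟩
  · intro w hw
    funext x
    exact hcancel _ _ _ ((hw x).trans (hv x).symm)
  · intro u hu
    refine ⟨?_, ?_⟩
    · have hset : {p : X × Circle | p.2 = u p.1} = {p : X × Circle |
          p.2 • j (Quotient.mk (MulAction.orbitRel Circle X) p.1) = p.1} := by
        ext ⟨x, z⟩
        constructor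
        · intro h
          have h' : z = u x := h
          subst h'
          exact hu x
        · intro h
          exact hcancel _ _ _ (Eq.trans h (hu x).symm)
      have hc : Continuous fun p : X × Circle =>
          p.2 • j (Quotient.mk (MulAction.orbitRel Circle X) p.1) :=
        continuous_snd.smul (hj_cont.comp (continuous_quotient_mk'.comp continuous_fst))
      have hcl := isClosed_eq hc continuous_fst
      rw [← hset] at hcl
      rw [continuous_iff_isClosed]
      intro C hC
      have himg := isClosedMap_fst_of_compactSpace _
        (hcl.inter (hC.preimage (continuous_snd : Continuous (Prod.snd : X × Circle → Circle))))
      convert himg using 1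
      ext x
      constructor
      · intro hx
        exact ⟨(x, u x), ⟨rfl, hx⟩, rfl⟩
      · rintro ⟨⟨y, z⟩, ⟨h1, h2⟩, rfl⟩
        have h1' : z = u y := h1
        subst h1'
        exact h2
    · intro ζ x
      have hq : Quotient.mk (MulAction.orbitRel Circle X) (ζ • x) =
          Quotient.mk (MulAction.orbitRel Circle X) x :=
        Quotient.sound (MulAction.orbitRel_apply.mpr ⟨ζ, rfl⟩)
      have h := hu (ζ • x)
      rw [hq] at h
      apply hcancel _ _ _ (h.trans _)
      rw [mul_smul, hu x]
end

section
/- Let X be a compact Hausdorff space equipped with a continuous action of the circle group 𝕋. Then the induced action α of 𝕋 on C(X) has the Rokhlin property if and only if there exists a continuous map u : X → 𝕋 such that u(ζ·x) = ζ⁻¹·u(x) for all ζ ∈ 𝕋 and x ∈ X. -/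
/-- The induced circle action on `C(X)` has the Rokhlin property if and only if there is a
continuous map `u : X → 𝕋` satisfying `u(ζ • x) = ζ⁻¹ * u(x)`. -/
theorem rokhlinC_iff_exists_equivariant_map (X : Type*) [TopologicalSpace X] [CompactSpace X]
    [T2Space X] [MulAction Circle X] [ContinuousSMul Circle X] :
    RokhlinC X ↔
      ∃ u : X → Circle, Continuous u ∧
        ∀ (ζ : Circle) (x : X), u (ζ • x) = ζ⁻¹ * u x := by
  constructor
  · intro h
    obtain ⟨u, hu, h1, -⟩ := h (1 / 2) (by norm_num) ∅
    have hux : ∀ x, ‖u x‖ = 1 := by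
      intro x
      have h2 : star u * u = 1 := (Unitary.mem_iff.mp hu).1
      have h3 : star (u x) * u x = 1 := by
        have := congrArg (fun f : C(X, ℂ) => f x) h2
        simpa using this
      have h4 : ‖star (u x) * u x‖ = 1 := by rw [h3]; simp
      rw [norm_mul, norm_star] at h4
      nlinarith [norm_nonneg (u x)]
    -- the curve in `C(X, ℂ)`
    let G : C(ℝ × X, ℂ) :=
      ⟨fun p => (Circle.exp p.1 : ℂ) * u (Circle.exp p.1 • p.2), by fun_prop⟩
    let g : C(ℝ, C(X, ℂ)) := G.curry
    have hg : ∀ t x, g t x = (Circle.exp t : ℂ) * u (Circle.exp t • x) := fun t x => rfl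
    let v : C(X, ℂ) := ∫ t in (0 : ℝ)..(2 * Real.pi), g t
    have hv : ∀ x, v x = ∫ t in (0 : ℝ)..(2 * Real.pi), g t x := by
      intro x
      have := (ContinuousMap.evalCLM ℂ x : C(X, ℂ) →L[ℂ] ℂ).intervalIntegral_comp_comm
        (g.continuous.intervalIntegrable (μ := MeasureTheory.volume) 0 (2 * Real.pi))
      exact this.symm
    have hgc : ∀ x, Continuous fun t => g t x := by
      intro x
      simp only [hg]
      fun_prop
    have heq : ∀ (ζ : Circle) (x : X), v (ζ • x) = ((ζ⁻¹ : Circle) : ℂ) * v x := by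
      intro ζ x
      obtain ⟨s, rfl⟩ := Circle.exp_surjective ζ
      have hper : Function.Periodic (fun t => g t x) (2 * Real.pi) := by
        intro t
        simp only [hg, Circle.exp_add, Circle.exp_two_pi, mul_one]
      have e1 : ∀ t, g t (Circle.exp s • x)
          = (((Circle.exp s)⁻¹ : Circle) : ℂ) * g (t + s) x := by
        intro t
        simp only [hg, Circle.exp_add, mul_smul, Circle.coe_mul, Circle.coe_inv]
        have : (Circle.exp s : ℂ) ≠ 0 := Circle.coe_ne_zero _
        field_simp
      rw [hv, hv]
      simp only [e1]
      rw [intervalIntegral.integral_const_mul,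
        intervalIntegral.integral_comp_add_right (fun t => g t x)]
      congr 1
      have := hper.intervalIntegral_add_eq s 0
      simpa [add_comm] using this
    have hv0 : ∀ x, v x ≠ 0 := by
      intro x hx
      have b : ∀ t, ‖g t x - u x‖ ≤ 1 / 2 := by
        intro t
        have h2 := (ContinuousMap.norm_coe_le_norm _ x).trans (h1 (Circle.exp t)⁻¹).le
        have h3 : (inducedAct (Circle.exp t)⁻¹ u - (((Circle.exp t)⁻¹ : Circle) : ℂ) • u) x
            = (((Circle.exp t)⁻¹ : Circle) : ℂ) * (g t x - u x) := by
          have : (Circle.exp t : ℂ) ≠ 0 := Circle.coe_ne_zero _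
          simp only [hg, inducedAct, ContinuousMap.sub_apply, ContinuousMap.smul_apply,
            ContinuousMap.comp_apply, ContinuousMap.coe_mk, inv_inv, smul_eq_mul,
            Circle.coe_inv]
          field_simp
        rw [h3, norm_mul, Circle.norm_coe, one_mul] at h2
        exact h2
      have h4 := intervalIntegral.norm_integral_le_of_norm_le_const
        (a := 0) (b := 2 * Real.pi) (f := fun t => g t x - u x) (C := 1 / 2) (fun t _ => b t)
      rw [intervalIntegral.integral_sub ((hgc x).intervalIntegrable _ _) (by simp),
        ← hv, hx, intervalIntegral.integral_const, zero_sub, norm_neg, norm_smul, hux] at h4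
      have := Real.pi_pos
      simp only [sub_zero, Real.norm_eq_abs, abs_of_pos (Real.two_pi_pos)] at h4
      linarith
    have hn : ∀ x, ‖v x / (‖v x‖ : ℂ)‖ = 1 := by
      intro x
      simp [hv0 x]
    refine ⟨fun x => ⟨v x / (‖v x‖ : ℂ), mem_sphere_zero_iff_norm.mpr (hn x)⟩, ?_, ?_⟩
    · refine Continuous.subtype_mk ?_ _
      refine v.continuous.div (by fun_prop) ?_
      intro x
      simpa using hv0 x
    · intro ζ x
      apply Circle.ext
      change v (ζ • x) / (‖v (ζ • x)‖ : ℂ) = ((ζ⁻¹ : Circle) : ℂ) * (v x / (‖v x‖ : ℂ))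
      rw [heq, norm_mul, Circle.norm_coe, one_mul, mul_div_assoc]
  · rintro ⟨u, hc, hu⟩ ε hε F
    refine ⟨⟨fun x => (u x : ℂ), by fun_prop⟩, ?_, ?_, ?_⟩
    · rw [Unitary.mem_iff]
      constructor <;> ext x <;> simp [← Circle.coe_inv_eq_conj]
    · intro ζ
      have : inducedAct ζ (⟨fun x => (u x : ℂ), by fun_prop⟩ : C(X, ℂ))
          - (ζ : ℂ) • (⟨fun x => (u x : ℂ), by fun_prop⟩ : C(X, ℂ)) = 0 := by
        ext x
        simp [inducedAct, hu]
      rw [this]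
      simpa using hε
    · intro a _
      rw [mul_comm, sub_self]
      simpa using hε
end
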